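/- For every β > 0 there exists a constant C₁, depending only on β, h and the graph G (and μ, w), such that for every u ∈ H one has J_β(u) ≥ (1/4) ∫_V |∇u|² dμ + C₁, where J_β(u) = (1/2)∫_V |∇u|² dμ − β log ∫_V h e^u dμ. In particular, J_β is bounded below and coercive on H. -/

import Mathlib

open Finset

variable {V : Type*}

/-- Integral of `g` over `V` with respect to the measure `μ`. -/
noncomputable def intV [Fintype V] (μ g : V → ℝ) : ℝ := ∑ x, μ x * g x

/-- Volume of `V` with respect to the measure `μ`. -/
noncomputable def volV [Fintype V] (μ : V → ℝ) : ℝ := ∑ x, μ x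

/-- The space `H` of functions with zero mean. -/
def Hsp [Fintype V] (μ : V → ℝ) : Set (V → ℝ) := {u | intV μ u = 0}

/-- `|∇u|²(x)`, the squared length of the gradient of `u` at `x`. -/
noncomputable def gradSq [Fintype V] (G : SimpleGraph V) [DecidableRel G.Adj]
    (w : V → V → ℝ) (μ : V → ℝ) (u : V → ℝ) (x : V) : ℝ :=
  (1 / (2 * μ x)) * ∑ y, if G.Adj x y then w x y * (u y - u x) ^ 2 else 0

/-- The `μ`-Laplacian `Δu(x)`. -/
noncomputable def lapV [Fintype V] (G : SimpleGraph V) [DecidableRel G.Adj]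
    (w : V → V → ℝ) (μ : V → ℝ) (u : V → ℝ) (x : V) : ℝ :=
  (1 / μ x) * ∑ y, if G.Adj x y then w x y * (u y - u x) else 0

/-- The functional `J_β`. -/
noncomputable def Jb [Fintype V] (G : SimpleGraph V) [DecidableRel G.Adj]
    (w : V → V → ℝ) (μ h : V → ℝ) (β : ℝ) (u : V → ℝ) : ℝ :=
  (1 / 2) * intV μ (gradSq G w μ u)
    - β * Real.log (intV μ (fun x => h x * Real.exp (u x)))

/-- The functional `J_{α,β}`. -/
noncomputable def Jab [Fintype V] (G : SimpleGraph V) [DecidableRel G.Adj]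
    (w : V → V → ℝ) (μ h : V → ℝ) (α β : ℝ) (u : V → ℝ) : ℝ :=
  (1 / 2) * intV μ (fun x => gradSq G w μ u x - α * u x ^ 2)
    - β * Real.log (intV μ (fun x => h x * Real.exp (u x)))

/-- The first non-zero eigenvalue `λ₁(V)` of `-Δ`, defined variationally. -/
noncomputable def lam1V [Fintype V] (G : SimpleGraph V) [DecidableRel G.Adj]
    (w : V → V → ℝ) (μ : V → ℝ) : ℝ :=
  sInf ((fun u => intV μ (gradSq G w μ u)) ''
    {u | u ∈ Hsp μ ∧ intV μ (fun x => u x ^ 2) = 1})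

/-- The eigenspace of `-Δ` with eigenvalue `c` (inside `H`). -/
def eigSp [Fintype V] (G : SimpleGraph V) [DecidableRel G.Adj]
    (w : V → V → ℝ) (μ : V → ℝ) (c : ℝ) : Set (V → ℝ) :=
  {v | intV μ v = 0 ∧ ∀ x, -(lapV G w μ v x) = c * v x}

/-- `E_k^⊥`: functions in `H` orthogonal to the eigenspaces of the first `k`
distinct non-zero eigenvalues (`lam` lists the distinct non-zero eigenvalues,
0-indexed, so `lam ⟨s⟩` is `λ_{s+1}(V)`). -/
def EkPerp [Fintype V] (G : SimpleGraph V) [DecidableRel G.Adj]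
    (w : V → V → ℝ) (μ : V → ℝ) {m : ℕ} (lam : Fin m → ℝ) (k : ℕ) : Set (V → ℝ) :=
  {u | u ∈ Hsp μ ∧ ∀ s : Fin m, (s : ℕ) < k → ∀ v ∈ eigSp G w μ (lam s),
    intV μ (fun x => u x * v x) = 0}

theorem intV_gradSq [Fintype V] (G : SimpleGraph V) [DecidableRel G.Adj]
    (w : V → V → ℝ) {μ : V → ℝ} (hμ : ∀ x, 0 < μ x) (u : V → ℝ) :
    intV μ (gradSq G w μ u) =
      ∑ x, (1 / 2) * ∑ y, if G.Adj x y then w x y * (u y - u x) ^ 2 else 0 := by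
  unfold intV gradSq
  refine Finset.sum_congr rfl fun x _ => ?_
  have := (hμ x).ne'
  field_simp

theorem sum_edge_nonneg [Fintype V] (G : SimpleGraph V) [DecidableRel G.Adj]
    {w : V → V → ℝ} (hwp : ∀ x y, G.Adj x y → 0 < w x y) (u : V → ℝ) (x y : V) :
    0 ≤ if G.Adj x y then w x y * (u y - u x) ^ 2 else 0 := by
  split_ifs with hxy
  · exact mul_nonneg (hwp x y hxy).le (sq_nonneg _)
  · exact le_rfl

theorem intV_gradSq_nonneg [Fintype V] (G : SimpleGraph V) [DecidableRel G.Adj]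
    {w : V → V → ℝ} (hwp : ∀ x y, G.Adj x y → 0 < w x y)
    {μ : V → ℝ} (hμ : ∀ x, 0 < μ x) (u : V → ℝ) :
    0 ≤ intV μ (gradSq G w μ u) := by
  rw [intV_gradSq G w hμ]
  exact Finset.sum_nonneg fun x _ => mul_nonneg (by norm_num)
    (Finset.sum_nonneg fun y _ => sum_edge_nonneg G hwp u x y)

theorem mul_sq_sub_le_intV_gradSq [Fintype V] (G : SimpleGraph V) [DecidableRel G.Adj]
    {w : V → V → ℝ} (hwp : ∀ x y, G.Adj x y → 0 < w x y)
    {μ : V → ℝ} (hμ : ∀ x, 0 < μ x) (u : V → ℝ) {x y : V} (hxy : G.Adj x y) :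
    w x y * (u y - u x) ^ 2 ≤ 2 * intV μ (gradSq G w μ u) := by
  rw [intV_gradSq G w hμ]
  have h1 := Finset.single_le_sum (fun z _ => sum_edge_nonneg G hwp u x z) (Finset.mem_univ y)
  have h2 := Finset.single_le_sum
    (f := fun x => (1 / 2) * ∑ y, if G.Adj x y then w x y * (u y - u x) ^ 2 else 0)
    (fun z _ => mul_nonneg (by norm_num)
      (Finset.sum_nonneg fun y _ => sum_edge_nonneg G hwp u z y)) (Finset.mem_univ x)
  rw [if_pos hxy] at h1
  linarith

/-- Differences of `u` along a path are controlled by the Dirichlet energy. -/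
theorem exists_sub_le_sqrt_of_reachable [Fintype V] (G : SimpleGraph V) [DecidableRel G.Adj]
    {w : V → V → ℝ} (hwp : ∀ x y, G.Adj x y → 0 < w x y)
    {μ : V → ℝ} (hμ : ∀ x, 0 < μ x) {x y : V} (hxy : G.Reachable x y) :
    ∃ K : ℝ, 0 ≤ K ∧ ∀ u : V → ℝ, u y - u x ≤ K * √(intV μ (gradSq G w μ u)) := by
  obtain ⟨p⟩ := hxy
  induction p with
  | nil => exact ⟨0, le_rfl, fun u => by simp⟩
  | @cons a b c hab p ih =>
    obtain ⟨K, hK, hKu⟩ := ih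
    refine ⟨√(2 / w a b) + K, by positivity, fun u => ?_⟩
    have hw := hwp a b hab
    have hedge : u b - u a ≤ √(2 / w a b) * √(intV μ (gradSq G w μ u)) := by
      rw [← Real.sqrt_mul (by positivity)]
      apply Real.le_sqrt_of_sq_le
      rw [div_mul_eq_mul_div, le_div_iff₀ hw, mul_comm]
      exact mul_sq_sub_le_intV_gradSq G hwp hμ u hab
    linarith [hKu u]

theorem exists_nonpos_of_mem_Hsp [Fintype V] [Nonempty V] {μ : V → ℝ} (hμ : ∀ x, 0 < μ x)
    {u : V → ℝ} (hu : u ∈ Hsp μ) : ∃ x, u x ≤ 0 := by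
  by_contra! hpos
  have : 0 < intV μ u :=
    Finset.sum_pos (fun x _ => mul_pos (hμ x) (hpos x)) Finset.univ_nonempty
  exact this.ne' hu

/-- A mean-zero function is bounded above by a multiple of the root of its Dirichlet energy. -/
theorem exists_le_sqrt_of_connected [Fintype V] (G : SimpleGraph V) [DecidableRel G.Adj]
    (hG : G.Connected) {w : V → V → ℝ} (hwp : ∀ x y, G.Adj x y → 0 < w x y)
    {μ : V → ℝ} (hμ : ∀ x, 0 < μ x) :
    ∃ K : ℝ, ∀ u ∈ Hsp μ, ∀ x, u x ≤ K * √(intV μ (gradSq G w μ u)) := by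
  have := hG.nonempty
  choose K hK hKu using fun x y : V =>
    exists_sub_le_sqrt_of_reachable G hwp hμ (hG.preconnected x y)
  refine ⟨∑ x, ∑ y, K x y, fun u hu y => ?_⟩
  obtain ⟨x, hx⟩ := exists_nonpos_of_mem_Hsp hμ hu
  have h1 : K x y ≤ ∑ z, K x z :=
    Finset.single_le_sum (fun z _ => hK x z) (Finset.mem_univ y)
  have h2 : ∑ z, K x z ≤ ∑ t, ∑ z, K t z :=
    Finset.single_le_sum (f := fun t => ∑ z, K t z)
      (fun t _ => Finset.sum_nonneg fun z _ => hK t z) (Finset.mem_univ x)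
  have h3 := mul_le_mul_of_nonneg_right (h1.trans h2) (Real.sqrt_nonneg (intV μ (gradSq G w μ u)))
  linarith [hKu x y u]

theorem log_intV_mul_exp_le [Fintype V] [Nonempty V] {μ h : V → ℝ} (hμ : ∀ x, 0 < μ x)
    (hh : ∀ x, 0 < h x) {u : V → ℝ} {M : ℝ} (hu : ∀ x, u x ≤ M) :
    Real.log (intV μ fun x => h x * Real.exp (u x)) ≤ Real.log (intV μ h) + M := by
  have hpos : 0 < intV μ h :=
    Finset.sum_pos (fun x _ => mul_pos (hμ x) (hh x)) Finset.univ_nonempty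
  have hpos' : 0 < intV μ fun x => h x * Real.exp (u x) :=
    Finset.sum_pos (fun x _ => mul_pos (hμ x) (mul_pos (hh x) (Real.exp_pos _)))
      Finset.univ_nonempty
  rw [← Real.log_exp M, ← Real.log_mul hpos.ne' (Real.exp_pos M).ne']
  refine Real.log_le_log hpos' ?_
  unfold intV
  rw [Finset.sum_mul]
  refine Finset.sum_le_sum fun x _ => ?_
  rw [← mul_assoc]
  exact mul_le_mul_of_nonneg_left (Real.exp_le_exp.2 (hu x)) (mul_pos (hμ x) (hh x)).le

theorem stmt19 [Fintype V] (G : SimpleGraph V) [DecidableRel G.Adj]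
    (hG : G.Connected) (w : V → V → ℝ) (hws : ∀ x y, w x y = w y x)
    (hwp : ∀ x y, G.Adj x y → 0 < w x y)
    (μ : V → ℝ) (hμ : ∀ x, 0 < μ x) (h : V → ℝ) (hh : ∀ x, 0 < h x) (β : ℝ) (hβ : 0 < β) :
    ∃ C₁ : ℝ, ∀ u ∈ Hsp μ,
      (1 / 4) * intV μ (gradSq G w μ u) + C₁ ≤ Jb G w μ h β u := by
  have := hG.nonempty
  obtain ⟨K, hK⟩ := exists_le_sqrt_of_connected G hG hwp hμ
  refine ⟨-(β * Real.log (intV μ h)) - (β * K) ^ 2, fun u hu => ?_⟩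
  have hlog := mul_le_mul_of_nonneg_left (log_intV_mul_exp_le hμ hh (hK u hu)) hβ.le
  have hsq := Real.sq_sqrt (intV_gradSq_nonneg G hwp hμ u)
  unfold Jb
  nlinarith [sq_nonneg (√(intV μ (gradSq G w μ u)) / 2 - β * K)]
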